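/- arXiv:1804.00228 — 3 statements merged into one kernel-verified Lean document; each statement's English description precedes it below -/
import Mathlib

section
/- Let A be a commutative ring, let π ∈ A be an element that is not a zero divisor, let q ≥ 1 be a natural number, and let φ₁, φ₂ : A → A be ring homomorphisms such that π divides φᵢ(x) − x^q for every x ∈ A and i = 1, 2. Let D : A → A be the unique function with π·D(x) = φ₁(x) − φ₂(x) for all x. Then D is additive (D(x+y) = D(x) + D(y)), D(1) = 0, D(x·y) = φ₁(x)·D(y) + D(x)·φ₂(y) for all x, y, and π divides D(x·y) − x^q·D(y) − D(x)·y^q for all x, y. -/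
/-- The difference of two lifts of the `q`-power Frobenius, divided by a
non-zero-divisor `π`, is additive, kills `1`, satisfies a twisted Leibniz rule, and is a
Frobenius-semilinear derivation modulo `π`. -/
theorem difference_of_frobenius_lifts
    {A : Type*} [CommRing A] (π : A) (hπ : π ∈ nonZeroDivisors A)
    (q : ℕ) (hq : 1 ≤ q) (φ₁ φ₂ : A →+* A)
    (hφ₁ : ∀ x : A, π ∣ φ₁ x - x ^ q) (hφ₂ : ∀ x : A, π ∣ φ₂ x - x ^ q) :
    (∃! D : A → A, ∀ x : A, π * D x = φ₁ x - φ₂ x) ∧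
    (∀ D : A → A, (∀ x : A, π * D x = φ₁ x - φ₂ x) →
      (∀ x y : A, D (x + y) = D x + D y) ∧
      D 1 = 0 ∧
      (∀ x y : A, D (x * y) = φ₁ x * D y + D x * φ₂ y) ∧
      (∀ x y : A, π ∣ D (x * y) - x ^ q * D y - D x * y ^ q)) := by
  have cancel : ∀ {a b : A}, π * a = π * b → a = b := fun h =>
    (mul_cancel_left_mem_nonZeroDivisors hπ).mp h
  refine ⟨?_, fun D hD => ?_⟩
  · have hdvd : ∀ x : A, π ∣ φ₁ x - φ₂ x := fun x => by
      simpa using dvd_sub (hφ₁ x) (hφ₂ x)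
    choose D hD using hdvd
    exact ⟨D, fun x => (hD x).symm, fun E hE => funext fun x => cancel ((hE x).trans (hD x))⟩
  · have leibniz : ∀ x y : A, D (x * y) = φ₁ x * D y + D x * φ₂ y := fun x y => cancel <| by
      rw [hD, map_mul, map_mul]
      linear_combination -φ₁ x * hD y - φ₂ y * hD x
    refine ⟨fun x y => cancel ?_, cancel ?_, leibniz, fun x y => ?_⟩
    · rw [mul_add, hD, hD, hD, map_add, map_add]
      ring
    · rw [hD, map_one, map_one, sub_self, mul_zero]
    · have h : D (x * y) - x ^ q * D y - D x * y ^ q =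
          (φ₁ x - x ^ q) * D y + D x * (φ₂ y - y ^ q) := by
        rw [leibniz]
        ring
      rw [h]
      exact dvd_add ((hφ₁ x).mul_right _) ((hφ₂ y).mul_left _)
end

section
/- Let p be a prime, let A and B be commutative rings, let g : A → B be a ring homomorphism, and let δ : A → B be a function. Define f : A → TruncatedWittVector p 2 B by letting f(x) be the truncated Witt vector with coordinates (g(x), δ(x)). Then f is a ring homomorphism if and only if δ(1) = 0 and, for all x, y ∈ A, δ(x·y) = g(x)^p·δ(y) + δ(x)·g(y)^p + p·δ(x)·δ(y) and δ(x+y) = δ(x) + δ(y) − ∑_{j=1}^{p−1} (C(p,j)/p)·g(x)^{p−j}·g(y)^j. -/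
namespace WittVector

variable {p : ℕ} [hp : Fact p.Prime] {R : Type*} [CommRing R]

theorem ghostComponent_one_apply (x : WittVector p R) :
    ghostComponent 1 x = p * x.coeff 1 + x.coeff 0 ^ p := by
  simp [ghostComponent_apply, wittPolynomial_one]

/-- Every Witt vector lifts to Witt vectors over a domain of characteristic zero. -/
theorem map_aeval_id_surjective :
    Function.Surjective
      (map (p := p) (MvPolynomial.aeval (R := ℤ) (id : R → R)).toRingHom) :=
  map_surjective _ fun r => ⟨MvPolynomial.X r, by simp⟩

theorem mul_coeff_one (x y : WittVector p R) :
    (x * y).coeff 1 = x.coeff 0 ^ p * y.coeff 1 + x.coeff 1 * y.coeff 0 ^ p +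
      p * x.coeff 1 * y.coeff 1 := by
  obtain ⟨x, rfl⟩ := map_aeval_id_surjective x
  obtain ⟨y, rfl⟩ := map_aeval_id_surjective y
  have hp0 : (p : MvPolynomial R ℤ) ≠ 0 := Nat.cast_ne_zero.mpr hp.out.ne_zero
  have h : (x * y).coeff 1 = x.coeff 0 ^ p * y.coeff 1 + x.coeff 1 * y.coeff 0 ^ p +
      p * x.coeff 1 * y.coeff 1 := by
    have hg := map_mul (ghostComponent 1) x y
    simp only [ghostComponent_one_apply, mul_coeff_zero] at hg
    apply mul_left_cancel₀ hp0
    linear_combination hg - mul_pow (x.coeff 0) (y.coeff 0) p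
  rw [← map_mul, map_coeff, h]
  simp only [map_coeff, map_add, map_mul, map_pow, map_natCast]

/-- The binomial theorem for a prime exponent, with the factor `p` of the middle terms extracted. -/
theorem add_pow_prime_eq (a b : R) :
    (a + b) ^ p = a ^ p + b ^ p +
      p * ∑ j ∈ Finset.Ico 1 p, ((p.choose j / p : ℕ) : R) * a ^ (p - j) * b ^ j := by
  rw [add_comm a b, add_pow, Finset.sum_range_succ, Finset.range_eq_Ico,
    Finset.sum_eq_sum_Ico_succ_bot hp.out.pos, Finset.mul_sum]
  have h : ∀ j ∈ Finset.Ico 1 p, b ^ j * a ^ (p - j) * (p.choose j : R) =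
      p * (((p.choose j / p : ℕ) : R) * a ^ (p - j) * b ^ j) := by
    intro j hj
    rw [Finset.mem_Ico] at hj
    have hc : (p : R) * ((p.choose j / p : ℕ) : R) = p.choose j := by
      rw [← Nat.cast_mul, Nat.mul_div_cancel' (hp.out.dvd_choose_self (by omega) hj.2)]
    linear_combination -(b ^ j * a ^ (p - j)) * hc
  rw [zero_add, Finset.sum_congr rfl h]
  simp
  ring

theorem add_coeff_one (x y : WittVector p R) :
    (x + y).coeff 1 = x.coeff 1 + y.coeff 1 -
      ∑ j ∈ Finset.Ico 1 p,
        ((p.choose j / p : ℕ) : R) * x.coeff 0 ^ (p - j) * y.coeff 0 ^ j := by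
  obtain ⟨x, rfl⟩ := map_aeval_id_surjective x
  obtain ⟨y, rfl⟩ := map_aeval_id_surjective y
  have hp0 : (p : MvPolynomial R ℤ) ≠ 0 := Nat.cast_ne_zero.mpr hp.out.ne_zero
  have h : (x + y).coeff 1 = x.coeff 1 + y.coeff 1 - ∑ j ∈ Finset.Ico 1 p,
      ((p.choose j / p : ℕ) : MvPolynomial R ℤ) * x.coeff 0 ^ (p - j) * y.coeff 0 ^ j := by
    have hg := map_add (ghostComponent 1) x y
    simp only [ghostComponent_one_apply, add_coeff_zero] at hg
    apply mul_left_cancel₀ hp0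
    linear_combination hg - add_pow_prime_eq (p := p) (x.coeff 0) (y.coeff 0)
  rw [← map_add, map_coeff, h]
  simp only [map_coeff, map_add, map_sub, map_sum, map_mul, map_pow, map_natCast]

end WittVector

namespace TruncatedWittVector

theorem mk_two_eq_iff {p : ℕ} {R : Type*} {a b c d : R} :
    mk p ![a, b] = mk p ![c, d] ↔ a = c ∧ b = d := by
  change (![a, b] : Fin 2 → R) = ![c, d] ↔ _
  simp

theorem truncateFun_two {p : ℕ} {R : Type*} (w : WittVector p R) :
    WittVector.truncateFun 2 w = mk p ![w.coeff 0, w.coeff 1] := by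
  ext i
  fin_cases i <;> simp [WittVector.coeff_truncateFun]

variable {p : ℕ} [hp : Fact p.Prime] {R : Type*} [CommRing R]

theorem one_eq_mk_two : (1 : TruncatedWittVector p 2 R) = mk p ![1, 0] := by
  rw [← WittVector.truncateFun_one, truncateFun_two]
  simp

theorem mk_two_mul (a b c d : R) :
    mk p ![a, b] * mk p ![c, d] = mk p ![a * c, a ^ p * d + b * c ^ p + p * b * d] := by
  rw [← truncateFun_out (mk p ![a, b]), ← truncateFun_out (mk p ![c, d]),
    ← WittVector.truncateFun_mul, truncateFun_two, WittVector.mul_coeff_zero,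
    WittVector.mul_coeff_one]
  simp [out]

theorem mk_two_add (a b c d : R) :
    mk p ![a, b] + mk p ![c, d] = mk p ![a + c, b + d -
      ∑ j ∈ Finset.Ico 1 p, ((p.choose j / p : ℕ) : R) * a ^ (p - j) * c ^ j] := by
  rw [← truncateFun_out (mk p ![a, b]), ← truncateFun_out (mk p ![c, d]),
    ← WittVector.truncateFun_add, truncateFun_two, WittVector.add_coeff_zero,
    WittVector.add_coeff_one]
  simp [out]

end TruncatedWittVector

open TruncatedWittVector in
/-- The map `x ↦ (g x, δ x)` into length-2 truncated `p`-typical Witt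
vectors is a ring homomorphism if and only if `δ` is a `p`-derivation relative to `g`,
i.e. `δ 1 = 0` together with the product rule and the sum rule. -/
theorem wittVector_mk_ringHom_iff_p_derivation
    (p : ℕ) [hp : Fact p.Prime] {A B : Type*} [CommRing A] [CommRing B]
    (g : A →+* B) (δ : A → B) :
    (∃ f : A →+* TruncatedWittVector p 2 B,
        ∀ x : A, f x = TruncatedWittVector.mk p ![g x, δ x]) ↔
      (δ 1 = 0 ∧
        (∀ x y : A,
          δ (x * y) = g x ^ p * δ y + δ x * g y ^ p + (p : B) * δ x * δ y) ∧
        (∀ x y : A,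
          δ (x + y) = δ x + δ y -
            ∑ j ∈ Finset.Ico 1 p,
              ((p.choose j / p : ℕ) : B) * g x ^ (p - j) * g y ^ j)) := by
  constructor
  · rintro ⟨f, hf⟩
    refine ⟨?_, fun x y => ?_, fun x y => ?_⟩
    · have h := map_one f
      rw [hf, one_eq_mk_two, mk_two_eq_iff] at h
      exact h.2
    · have h := map_mul f x y
      rw [hf, hf, hf, mk_two_mul, mk_two_eq_iff] at h
      exact h.2
    · have h := map_add f x y
      rw [hf, hf, hf, mk_two_add, mk_two_eq_iff] at h
      exact h.2
  · rintro ⟨h_one, h_mul, h_add⟩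
    refine ⟨RingHom.mk'
      { toFun := fun x => mk p ![g x, δ x]
        map_one' := by rw [one_eq_mk_two, map_one, h_one]
        map_mul' := fun x y => by rw [mk_two_mul, map_mul, h_mul] }
      fun x y => ?_, fun x => rfl⟩
    change mk p ![g (x + y), δ (x + y)] = mk p ![g x, δ x] + mk p ![g y, δ y]
    rw [mk_two_add, map_add, h_add]
end

section
/- Let p be a prime, let σ be a type, let C be a commutative ring in which p is not a zero divisor, let φ_C : C → C be a ring homomorphism such that p divides φ_C(c) − c^p for every c ∈ C, and let β : MvPolynomial σ ℤ → C be a surjective ring homomorphism. Then there exists a ring endomorphism Φ of MvPolynomial σ ℤ such that p divides Φ(f) − f^p for every polynomial f, and β ∘ Φ = φ_C ∘ β. -/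
open MvPolynomial in
/-- A ring endomorphism of `MvPolynomial σ ℤ` is a Frobenius lift as soon as it lifts Frobenius
on the variables. -/
theorem MvPolynomial.dvd_map_sub_pow_of_forall_X {p : ℕ} (hp : p.Prime) {σ : Type*}
    (Φ : MvPolynomial σ ℤ →+* MvPolynomial σ ℤ)
    (hX : ∀ i, (p : MvPolynomial σ ℤ) ∣ Φ (X i) - X i ^ p) (f : MvPolynomial σ ℤ) :
    (p : MvPolynomial σ ℤ) ∣ Φ f - f ^ p := by
  induction f using MvPolynomial.induction_on with
  | C a =>
    have : Fact p.Prime := ⟨hp⟩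
    have ha : (p : ℤ) ∣ a - a ^ p := by
      rw [← ZMod.intCast_zmod_eq_zero_iff_dvd]
      simp
    have hC : Φ (C a) = C a := by simp
    simpa [hC] using map_dvd (C : ℤ →+* MvPolynomial σ ℤ) ha
  | add f g hf hg =>
    obtain ⟨r, hr⟩ := exists_add_pow_prime_eq hp f g
    obtain ⟨s, hs⟩ := hf
    obtain ⟨t, ht⟩ := hg
    refine ⟨s + t - f * g * r, ?_⟩
    rw [map_add, hr]
    linear_combination hs + ht
  | mul_X f i hf =>
    obtain ⟨s, hs⟩ := hf
    obtain ⟨t, ht⟩ := hX i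
    refine ⟨s * Φ (X i) + f ^ p * t, ?_⟩
    rw [map_mul, mul_pow]
    linear_combination Φ (X i) * hs + f ^ p * ht

/-- Along a surjection `β` from a polynomial ring over `ℤ` onto a ring `C`
in which `p` is not a zero divisor, any Frobenius lift `φ_C` on `C` lifts to a
compatible Frobenius lift `Φ` on the polynomial ring. -/
theorem frobenius_lift_along_surjection
    (p : ℕ) (hp : p.Prime) (σ : Type*) {C : Type*} [CommRing C]
    (hpC : (p : C) ∈ nonZeroDivisors C)
    (φC : C →+* C) (hφC : ∀ c : C, (p : C) ∣ φC c - c ^ p)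
    (β : MvPolynomial σ ℤ →+* C) (hβ : Function.Surjective β) :
    ∃ Φ : MvPolynomial σ ℤ →+* MvPolynomial σ ℤ,
      (∀ f : MvPolynomial σ ℤ, (p : MvPolynomial σ ℤ) ∣ Φ f - f ^ p) ∧
      (∀ f : MvPolynomial σ ℤ, β (Φ f) = φC (β f)) := by
  choose d hd using fun i => hφC (β (MvPolynomial.X i))
  choose e he using fun i => hβ (d i)
  let Φ : MvPolynomial σ ℤ →+* MvPolynomial σ ℤ :=
    MvPolynomial.eval₂Hom MvPolynomial.C fun i => MvPolynomial.X i ^ p + (p : MvPolynomial σ ℤ) * e i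
  have hΦ (i : σ) : Φ (MvPolynomial.X i) = MvPolynomial.X i ^ p + (p : MvPolynomial σ ℤ) * e i :=
    MvPolynomial.eval₂Hom_X' _ _ i
  refine ⟨Φ, MvPolynomial.dvd_map_sub_pow_of_forall_X hp Φ fun i => ⟨e i, by simp [hΦ]⟩,
    fun f => ?_⟩
  have hcomp : β.comp Φ = φC.comp β := by
    refine MvPolynomial.ringHom_ext (fun a => by simp) fun i => ?_
    simp only [RingHom.comp_apply, hΦ, map_add, map_pow, map_mul, map_natCast, he]
    linear_combination -hd i
  exact RingHom.congr_fun hcomp f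
end
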